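/- Let A and B be r×r matrix functions with entries in H_2 of the unit disk, with \det A and \det B outer and not identically zero, and suppose A^{-1}B has boundary values in L_\infty of the unit circle. Then A^{-1}B extends to an H_\infty matrix function on the unit disk. -/

import Mathlib

open MeasureTheory Complex Metric Set Matrix
open scoped ComplexOrder

/-- Membership in the Hardy space `H_p` (`0 < p < ∞`) of the unit disk:
analytic on the open unit disk with uniformly bounded `p`-th power means. -/
def HardyMem (p : ℝ) (f : ℂ → ℂ) : Prop :=
  DifferentiableOn ℂ f (ball (0:ℂ) 1) ∧
  ∃ C : ℝ, ∀ r : ℝ, 0 ≤ r → r < 1 →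
    (∫ t in (0:ℝ)..(2 * Real.pi), ‖f ((r : ℂ) * Complex.exp (t * Complex.I))‖ ^ p) ≤ C

/-- Membership in `H_∞`: bounded analytic functions on the unit disk. -/
def HardyInfMem (f : ℂ → ℂ) : Prop :=
  DifferentiableOn ℂ f (ball (0:ℂ) 1) ∧ ∃ C : ℝ, ∀ z ∈ ball (0:ℂ) 1, ‖f z‖ ≤ C

/-- `F` is the boundary-value function of `f` : radial limits a.e. on the circle. -/
def IsBoundaryValue (f : ℂ → ℂ) (F : ℝ → ℂ) : Prop :=
  ∀ᵐ (t : ℝ) ∂(volume.restrict (Set.Ioc (0:ℝ) (2*Real.pi))),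
    Filter.Tendsto (fun r : ℝ => f ((r:ℂ) * Complex.exp (t * Complex.I)))
      (nhdsWithin 1 (Set.Iio 1)) (nhds (F t))

/-- `n`-th Fourier coefficient of a function on the unit circle. -/
noncomputable def fc (F : ℝ → ℂ) (n : ℤ) : ℂ :=
  (2 * Real.pi)⁻¹ * ∫ t in (0:ℝ)..(2*Real.pi), F t * Complex.exp (-(n : ℂ) * t * Complex.I)

/-- An outer function on the unit disk, given by the canonical exponential
representation with integrable `log k`. -/
def IsOuter (h : ℂ → ℂ) : Prop :=
  ∃ (c : ℂ) (k : ℝ → ℝ), ‖c‖ = 1 ∧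
    IntervalIntegrable (fun t => Real.log (k t)) volume 0 (2*Real.pi) ∧
    ∀ z ∈ ball (0:ℂ) 1,
      h z = c * Complex.exp (((2*Real.pi : ℝ) : ℂ)⁻¹ *
        ∫ t in (0:ℝ)..(2*Real.pi),
          ((Complex.exp (t*Complex.I) + z)/(Complex.exp (t*Complex.I) - z)) * (Real.log (k t) : ℂ))



theorem exists_differentiable_re_approx {g : ℂ → ℝ} (hg : ContinuousOn g (sphere (0:ℂ) 1))
    {ε : ℝ} (hε : 0 < ε) :
    ∃ Q : ℂ → ℂ, Differentiable ℂ Q ∧ ∀ z ∈ sphere (0:ℂ) 1, |g z - (Q z).re| ≤ ε := by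
  have : Fact (0 < 2 * Real.pi) := ⟨Real.two_pi_pos⟩
  let G : C(AddCircle (2 * Real.pi), ℂ) :=
    ⟨fun x => (g (AddCircle.toCircle x) : ℂ), by
      refine Complex.continuous_ofReal.comp (hg.comp_continuous ?_ ?_)
      · exact continuous_subtype_val.comp AddCircle.continuous_toCircle
      · intro x; simpa using Circle.norm_coe _⟩
  have hG : G ∈ (Submodule.span ℂ (range <| @fourier (2 * Real.pi))).topologicalClosure := by
    rw [span_fourier_closure_eq_top]; trivial
  obtain ⟨p, hp, hGp⟩ := Metric.mem_closure_iff.1 hG ε hε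
  have key : ∃ Q₁ Q₂ : ℂ → ℂ, Differentiable ℂ Q₁ ∧ Differentiable ℂ Q₂ ∧
      ∀ x : AddCircle (2 * Real.pi),
        p x = Q₁ (AddCircle.toCircle x) + starRingEnd ℂ (Q₂ (AddCircle.toCircle x)) := by
    clear hGp
    induction hp using Submodule.span_induction with
    | mem p hp =>
      obtain ⟨n, rfl⟩ := hp
      obtain ⟨n, rfl | rfl⟩ := n.eq_nat_or_neg
      · refine ⟨fun z => z ^ n, 0, by fun_prop, by fun_prop, fun x => ?_⟩
        simp [fourier_apply, AddCircle.toCircle_nsmul]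
      · refine ⟨0, fun z => z ^ n, by fun_prop, by fun_prop, fun x => ?_⟩
        simp [fourier_apply, AddCircle.toCircle_neg, AddCircle.toCircle_nsmul,
          Circle.coe_inv_eq_conj, -Circle.coe_inv]
    | zero => exact ⟨0, 0, by fun_prop, by fun_prop, by simp⟩
    | add p q _ _ hp hq =>
      obtain ⟨P₁, P₂, h1, h2, h⟩ := hp
      obtain ⟨Q₁, Q₂, k1, k2, k⟩ := hq
      refine ⟨P₁ + Q₁, P₂ + Q₂, h1.add k1, h2.add k2, fun x => ?_⟩
      simp [h, k]; ring
    | smul a p _ hp =>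
      obtain ⟨P₁, P₂, h1, h2, h⟩ := hp
      refine ⟨fun z => a * P₁ z, fun z => starRingEnd ℂ a * P₂ z, h1.const_mul _,
        h2.const_mul _, fun x => ?_⟩
      simp [h]; ring
  obtain ⟨Q₁, Q₂, h1, h2, h⟩ := key
  refine ⟨fun z => Q₁ z + Q₂ z, h1.add h2, fun z hz => ?_⟩
  obtain ⟨x, hx⟩ := (AddCircle.homeomorphCircle Real.two_pi_pos.ne').surjective
    ⟨z, mem_sphere_zero_iff_norm.1 hz |> fun h => by simp [Submonoid.unitSphere, h]⟩
  rw [AddCircle.homeomorphCircle_apply] at hx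
  have hx' : (AddCircle.toCircle x : ℂ) = z := by rw [hx]
  have := (ContinuousMap.dist_apply_le_dist x).trans hGp.le
  rw [dist_eq_norm, h x, hx'] at this
  refine le_trans (le_of_eq_of_le ?_ (Complex.abs_re_le_norm _)) this
  simp [G, hx']

theorem circleAverage_kernel_le {w : ℂ} (hw : w ∈ ball (0:ℂ) 1) {g : ℂ → ℝ}
    (hg : CircleIntegrable g 0 1) (h0 : ∀ z ∈ sphere (0:ℂ) 1, 0 ≤ g z) :
    Real.circleAverage ((re ∘ herglotzRieszKernel 0 w) • g) 0 1 ≤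
      (1 + ‖w‖) / (1 - ‖w‖) * Real.circleAverage g 0 1 := by
  rw [← smul_eq_mul, ← Real.circleAverage_smul]
  apply Real.circleAverage_mono
  · exact hg.continuousOn_smul
      (Complex.continuous_re.comp_continuousOn (continuousOn_herglotzRieszKernel_sphere hw))
  · exact hg.const_smul
  · intro z hz
    rw [abs_one] at hz
    have := re_herglotzRieszKernel_le hz hw
    simp only [sub_zero] at this
    simp only [Pi.smul_apply, smul_eq_mul, Pi.smul_apply', Function.comp, herglotzRieszKernel,
      sub_zero]
    exact mul_le_mul_of_nonneg_right this (h0 z hz)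

theorem circleAverage_kernel_nonneg {w : ℂ} (hw : w ∈ ball (0:ℂ) 1) {g : ℂ → ℝ}
    (h0 : ∀ z ∈ sphere (0:ℂ) 1, 0 ≤ g z) :
    0 ≤ Real.circleAverage ((re ∘ herglotzRieszKernel 0 w) • g) 0 1 := by
  have hw1 : ‖w‖ < 1 := by simpa using hw
  apply Real.circleAverage_nonneg_of_nonneg
  intro z hz
  rw [abs_one] at hz
  have h := le_re_herglotzRieszKernel hz hw
  simp only [sub_zero] at h
  simp only [Pi.smul_apply', smul_eq_mul, Function.comp, herglotzRieszKernel, sub_zero]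
  refine mul_nonneg (le_trans (div_nonneg ?_ ?_) h) (h0 z hz) <;> linarith [norm_nonneg w]

theorem circleIntegrable_kernel_smul {w : ℂ} (hw : w ∈ ball (0:ℂ) 1) {g : ℂ → ℝ}
    (hg : CircleIntegrable g 0 1) :
    CircleIntegrable ((re ∘ herglotzRieszKernel 0 w) • g) 0 1 :=
  hg.continuousOn_smul
    (Complex.continuous_re.comp_continuousOn (continuousOn_herglotzRieszKernel_sphere hw))

theorem posLog_norm_le_circleAverage {f : ℂ → ℂ} (hf : DiffContOnCl ℂ f (ball (0:ℂ) 1)) {w : ℂ}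
    (hw : w ∈ ball (0:ℂ) 1) :
    Real.posLog ‖f w‖ ≤ (1 + ‖w‖) / (1 - ‖w‖) *
      Real.circleAverage (fun z => Real.posLog ‖f z‖) 0 1 := by
  have hcl : closure (ball (0:ℂ) 1) = closedBall 0 1 := closure_ball _ one_ne_zero
  have hfc : ContinuousOn f (sphere 0 1) :=
    hf.continuousOn.mono (by rw [hcl]; exact sphere_subset_closedBall)
  have hgc : ContinuousOn (fun z => Real.posLog ‖f z‖) (sphere 0 1) :=
    Real.continuous_posLog.comp_continuousOn hfc.norm
  have hci : CircleIntegrable (fun z => Real.posLog ‖f z‖) 0 1 :=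
    ContinuousOn.circleIntegrable zero_le_one hgc
  have hw1 : ‖w‖ < 1 := by simpa using hw
  set K := (1 + ‖w‖) / (1 - ‖w‖) with hK
  have hK0 : 0 ≤ K := div_nonneg (by positivity) (by linarith)
  refine le_of_forall_pos_le_add fun η hη => ?_
  obtain ⟨ε, hε, hεη⟩ : ∃ ε > 0, K * (2 * ε) ≤ η :=
    ⟨η / (2 * (K + 1)), by positivity, by
      rw [show K * (2 * (η / (2 * (K + 1)))) = η * (K / (K + 1)) by field_simp]
      exact mul_le_of_le_one_right hη.le (div_le_one_of_le₀ (by linarith) (by positivity))⟩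
  obtain ⟨Q, hQ, hQg⟩ := exists_differentiable_re_approx (g := fun z => Real.posLog ‖f z‖ + ε)
    (hgc.add continuousOn_const) hε
  have hlow : ∀ z ∈ sphere (0:ℂ) 1, Real.posLog ‖f z‖ ≤ (Q z).re := fun z hz => by
    linarith [(abs_le.1 (hQg z hz)).2]
  have hup : ∀ z ∈ sphere (0:ℂ) 1, (Q z).re ≤ Real.posLog ‖f z‖ + 2 * ε := fun z hz => by
    linarith [(abs_le.1 (hQg z hz)).1]
  have hmax : ‖f w * Complex.exp (-Q w)‖ ≤ 1 := by
    refine Complex.norm_le_of_forall_mem_frontier_norm_le (f := fun z => f z * Complex.exp (-Q z))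
      isBounded_ball
      (hf.smul hQ.neg.cexp.diffContOnCl) ?_ (subset_closure hw)
    intro z hz
    rw [frontier_ball _ one_ne_zero] at hz
    rw [norm_mul, Complex.norm_exp, Complex.neg_re, Real.exp_neg, ← div_eq_mul_inv,
      div_le_one (Real.exp_pos _)]
    refine le_trans ?_ (Real.exp_le_exp.2 (hlow z hz))
    rw [Real.posLog_eq_log_max_one (norm_nonneg _), Real.exp_log (by positivity)]
    exact le_max_right _ _
  have hQint : CircleIntegrable (fun z => (Q z).re) 0 1 :=
    ContinuousOn.circleIntegrable zero_le_one
      (Complex.continuous_re.comp hQ.continuous).continuousOn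
  have hQ0 : ∀ z ∈ sphere (0:ℂ) 1, 0 ≤ (Q z).re := fun z hz =>
    Real.posLog_nonneg.trans (hlow z hz)
  have hrep : Real.circleAverage ((re ∘ herglotzRieszKernel 0 w) • fun z => (Q z).re) 0 1
      = (Q w).re := by
    have h := (hQ.diffContOnCl (s := ball (0:ℂ) 1)).circleAverage_re_herglotzRieszKernel_smul hw
    rw [← h]
    have hint : CircleIntegrable ((re ∘ herglotzRieszKernel 0 w) • Q) 0 1 :=
      (ContinuousOn.circleIntegrable zero_le_one hQ.continuous.continuousOn).continuousOn_smul
        (Complex.continuous_re.comp_continuousOn (continuousOn_herglotzRieszKernel_sphere hw))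
    have := (Complex.reCLM.circleAverage_comp_comm hint)
    simp only [Complex.reCLM_apply] at this
    rw [← this]
    congr 1
    ext z
    simp
  have hre : (Q w).re ≤ K * Real.circleAverage (fun z => Real.posLog ‖f z‖) 0 1 + η := by
    rw [← hrep]
    refine (circleAverage_kernel_le hw hQint hQ0).trans ?_
    have h1 : Real.circleAverage (fun z => (Q z).re) 0 1 ≤
        Real.circleAverage (fun z => Real.posLog ‖f z‖) 0 1 + 2 * ε := by
      rw [← Real.circleAverage_const (2 * ε) (0:ℂ) 1, ← Real.circleAverage_fun_add hci
        (circleIntegrable_const _ _ _)]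
      exact Real.circleAverage_mono hQint (hci.add (circleIntegrable_const _ _ _))
        (fun z hz => hup z (by simpa using hz))
    calc _ ≤ K * (Real.circleAverage (fun z => Real.posLog ‖f z‖) 0 1 + 2 * ε) := by gcongr
      _ ≤ _ := by linarith
  have hQw : 0 ≤ (Q w).re := by
    rw [← hrep]
    exact circleAverage_kernel_nonneg hw hQ0
  refine le_trans ?_ hre
  rw [norm_mul, Complex.norm_exp, Complex.neg_re, Real.exp_neg, ← div_eq_mul_inv,
      div_le_one (Real.exp_pos _)] at hmax
  rw [Real.posLog_eq_log_max_one (norm_nonneg _), Real.log_le_iff_le_exp (by positivity)]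
  exact max_le (Real.one_le_exp hQw) hmax

/-- Analytic functions on the unit disk whose `log⁺` has bounded square means on circles. -/
def LogSqMeanBounded (f : ℂ → ℂ) : Prop :=
  DifferentiableOn ℂ f (ball (0:ℂ) 1) ∧
  ∃ K : ℝ, ∀ ρ : ℝ, 0 ≤ ρ → ρ < 1 →
    ∫ t in (0:ℝ)..(2 * Real.pi),
      Real.posLog ‖f ((ρ : ℂ) * Complex.exp (t * Complex.I))‖ ^ 2 ≤ K

theorem mul_exp_mem_ball {ρ : ℝ} (h0 : 0 ≤ ρ) (h1 : ρ < 1) (t : ℝ) :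
    (ρ : ℂ) * Complex.exp (t * Complex.I) ∈ ball (0:ℂ) 1 := by
  simpa [Complex.norm_exp_ofReal_mul_I, abs_of_nonneg h0] using h1

theorem continuous_on_circle {f : ℂ → ℂ} (hf : DifferentiableOn ℂ f (ball (0:ℂ) 1))
    {ρ : ℝ} (h0 : 0 ≤ ρ) (h1 : ρ < 1) :
    Continuous fun t : ℝ => f ((ρ : ℂ) * Complex.exp (t * Complex.I)) :=
  hf.continuousOn.comp_continuous (by fun_prop) (mul_exp_mem_ball h0 h1)

theorem eventually_lt_and_lt_one {a : ℝ} (ha : a < 1) :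
    ∀ᶠ ρ : ℝ in nhdsWithin 1 (Set.Iio 1), a < ρ ∧ ρ < 1 :=
  Filter.eventually_of_mem (Ioo_mem_nhdsLT ha) fun _ h => h

theorem tendsto_integral_posLog {f : ℂ → ℂ} (hf : LogSqMeanBounded f)
    (hb : ∀ᵐ (t : ℝ) ∂(volume.restrict (Set.Ioc (0:ℝ) (2*Real.pi))),
      Filter.Tendsto (fun ρ : ℝ => Real.posLog ‖f ((ρ:ℂ) * Complex.exp (t * Complex.I))‖)
        (nhdsWithin 1 (Set.Iio 1)) (nhds 0)) :
    Filter.Tendsto (fun ρ : ℝ => ∫ t in (0:ℝ)..(2 * Real.pi),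
        Real.posLog ‖f ((ρ:ℂ) * Complex.exp (t * Complex.I))‖)
      (nhdsWithin 1 (Set.Iio 1)) (nhds 0) := by
  obtain ⟨hd, K, hK⟩ := hf
  have hcont : ∀ ρ : ℝ, 0 ≤ ρ → ρ < 1 → Continuous fun t : ℝ =>
      Real.posLog ‖f ((ρ:ℂ) * Complex.exp (t * Complex.I))‖ := fun ρ h0 h1 =>
    Real.continuous_posLog.comp (continuous_on_circle hd h0 h1).norm
  have hpos := Real.two_pi_pos
  have hK0 : 0 ≤ K :=
    (intervalIntegral.integral_nonneg hpos.le fun _ _ => sq_nonneg _).trans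
      (hK 0 le_rfl one_pos)
  have htrunc : ∀ L : ℝ, 0 ≤ L → Filter.Tendsto (fun ρ : ℝ => ∫ t in (0:ℝ)..(2 * Real.pi),
      min (Real.posLog ‖f ((ρ:ℂ) * Complex.exp (t * Complex.I))‖) L)
      (nhdsWithin 1 (Set.Iio 1)) (nhds 0) := by
    intro L hL
    have := intervalIntegral.tendsto_integral_filter_of_dominated_convergence (μ := volume)
      (a := 0) (b := 2 * Real.pi) (l := nhdsWithin (1:ℝ) (Set.Iio 1))
      (F := fun (ρ : ℝ) (t : ℝ) =>
        min (Real.posLog ‖f ((ρ:ℂ) * Complex.exp (t * Complex.I))‖) L)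
      (f := fun _ => 0) (fun _ => L) ?_ ?_ ?_ ?_
    · simpa using this
    · filter_upwards [eventually_lt_and_lt_one zero_lt_one] with ρ hρ
      exact ((hcont ρ hρ.1.le hρ.2).min continuous_const).aestronglyMeasurable
    · refine Filter.Eventually.of_forall fun ρ => Filter.Eventually.of_forall fun t _ => ?_
      rw [Real.norm_of_nonneg (le_min Real.posLog_nonneg hL)]
      exact min_le_right _ _
    · exact intervalIntegrable_const
    · rw [uIoc_of_le hpos.le, ← ae_restrict_iff' measurableSet_Ioc]
      filter_upwards [hb] with t ht
      simpa [min_eq_left hL] using ht.min (tendsto_const_nhds (x := L))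
  refine tendsto_order.2 ⟨fun a ha => ?_, fun a ha => ?_⟩
  · refine Filter.Eventually.of_forall fun ρ => ha.trans_le ?_
    exact intervalIntegral.integral_nonneg hpos.le fun _ _ => Real.posLog_nonneg
  · set L := 2 * (K + 1) / a with hL
    have hL0 : 0 < L := by positivity
    filter_upwards [(tendsto_order.1 (htrunc L hL0.le)).2 (a / 2) (by positivity),
      eventually_lt_and_lt_one zero_lt_one] with ρ h1 hρ
    have hc := hcont ρ hρ.1.le hρ.2
    have hKL : K / L < a / 2 := by
      rw [div_lt_iff₀ hL0, hL]
      field_simp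
      linarith
    calc ∫ t in (0:ℝ)..(2 * Real.pi), Real.posLog ‖f ((ρ:ℂ) * Complex.exp (t * Complex.I))‖
        ≤ ∫ t in (0:ℝ)..(2 * Real.pi),
          (min (Real.posLog ‖f ((ρ:ℂ) * Complex.exp (t * Complex.I))‖) L +
            Real.posLog ‖f ((ρ:ℂ) * Complex.exp (t * Complex.I))‖ ^ 2 / L) := by
          refine intervalIntegral.integral_mono_on hpos.le (hc.intervalIntegrable _ _)
            (((hc.min continuous_const).add ((hc.pow 2).div_const L)).intervalIntegrable _ _)
            fun t _ => ?_
          set x := Real.posLog ‖f ((ρ:ℂ) * Complex.exp (t * Complex.I))‖ with hx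
          have hx0 : 0 ≤ x := Real.posLog_nonneg
          rcases le_total x L with h | h
          · rw [min_eq_left h]
            have : 0 ≤ x ^ 2 / L := by positivity
            linarith
          · have : x ≤ x ^ 2 / L := by
              rw [le_div_iff₀ hL0]; nlinarith
            rw [min_eq_right h]; linarith
      _ = _ := intervalIntegral.integral_add
            ((hc.min continuous_const).intervalIntegrable _ _)
            (((hc.pow 2).div_const L).intervalIntegrable _ _)
      _ < a := by
          rw [intervalIntegral.integral_div]
          have := div_le_div_of_nonneg_right (hK ρ hρ.1.le hρ.2) hL0.le
          linarith

theorem norm_le_one_of_boundary {f : ℂ → ℂ} (hf : LogSqMeanBounded f)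
    (hb : ∀ᵐ (t : ℝ) ∂(volume.restrict (Set.Ioc (0:ℝ) (2*Real.pi))),
      Filter.Tendsto (fun ρ : ℝ => Real.posLog ‖f ((ρ:ℂ) * Complex.exp (t * Complex.I))‖)
        (nhdsWithin 1 (Set.Iio 1)) (nhds 0)) {w : ℂ} (hw : w ∈ ball (0:ℂ) 1) :
    ‖f w‖ ≤ 1 := by
  have hlim := tendsto_integral_posLog hf hb
  have hd := hf.1
  have hle : ∀ᶠ ρ : ℝ in nhdsWithin 1 (Set.Iio 1), Real.posLog ‖f (ρ * w)‖ ≤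
      (1 + ‖w‖) / (1 - ‖w‖) * ((2 * Real.pi)⁻¹ * ∫ t in (0:ℝ)..(2 * Real.pi),
        Real.posLog ‖f ((ρ:ℂ) * Complex.exp (t * Complex.I))‖) := by
    filter_upwards [eventually_lt_and_lt_one zero_lt_one] with ρ hρ
    have hdc : DiffContOnCl ℂ (fun z => f (ρ * z)) (ball (0:ℂ) 1) := by
      refine DifferentiableOn.diffContOnCl ?_
      rw [closure_ball _ one_ne_zero]
      refine hd.comp (by fun_prop) fun z hz => ?_
      have hz' : ‖z‖ ≤ 1 := by simpa using hz
      have : ρ * ‖z‖ < 1 := by nlinarith [norm_nonneg z, hρ.1, hρ.2]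
      simpa [abs_of_pos hρ.1] using this
    have := posLog_norm_le_circleAverage hdc hw
    simpa [Real.circleAverage_def, circleMap] using this
  have hleft : Filter.Tendsto (fun ρ : ℝ => Real.posLog ‖f (ρ * w)‖)
      (nhdsWithin 1 (Set.Iio 1)) (nhds (Real.posLog ‖f w‖)) := by
    have hcw : ContinuousAt f w := (hd.differentiableAt (isOpen_ball.mem_nhds hw)).continuousAt
    have hmul : Filter.Tendsto (fun ρ : ℝ => (ρ : ℂ) * w) (nhdsWithin 1 (Set.Iio 1)) (nhds w) := by
      have : Continuous fun ρ : ℝ => (ρ : ℂ) * w := by fun_prop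
      simpa using (this.tendsto 1).mono_left nhdsWithin_le_nhds
    exact (Real.continuous_posLog.tendsto _).comp (hcw.tendsto.comp hmul).norm
  have h0 : Real.posLog ‖f w‖ ≤ 0 := by
    refine le_of_tendsto_of_tendsto hleft ?_ hle
    simpa using (hlim.const_mul (2 * Real.pi)⁻¹).const_mul ((1 + ‖w‖) / (1 - ‖w‖))
  have := (Real.posLog_eq_zero_iff _).1 (le_antisymm h0 Real.posLog_nonneg)
  simpa using this

theorem integral_const_add_mul_sum {ι : Type*} [Fintype ι] {g : ι → ι → ℝ → ℝ}
    (hg : ∀ i j, Continuous (g i j)) (a b x y : ℝ) :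
    ∫ t in x..y, (a + b * (1 + ∑ i, ∑ j, g i j t)) =
      (y - x) * a + b * ((y - x) + ∑ i, ∑ j, ∫ t in x..y, g i j t) := by
  rw [intervalIntegral.integral_add intervalIntegrable_const
      (Continuous.intervalIntegrable (by fun_prop) _ _),
    intervalIntegral.integral_const_mul, intervalIntegral.integral_add intervalIntegrable_const
      (Continuous.intervalIntegrable (by fun_prop) _ _),
    intervalIntegral.integral_finsetSum
      fun i _ => Continuous.intervalIntegrable (by fun_prop) _ _]
  simp_rw [intervalIntegral.integral_finsetSum
    fun j _ => Continuous.intervalIntegrable (hg _ j) _ _]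
  simp

theorem logSqMeanBounded_det {r : ℕ} {X : ℂ → Matrix (Fin r) (Fin r) ℂ}
    (hX : ∀ i j, HardyMem 2 (fun z => X z i j)) : LogSqMeanBounded (fun z => (X z).det) := by
  constructor
  · simp only [Matrix.det_apply]
    exact DifferentiableOn.fun_sum fun σ _ =>
      (DifferentiableOn.fun_finsetProd fun i _ => (hX _ _).1).const_smul _
  choose C hC using fun i j => (hX i j).2
  refine ⟨2 * Real.pi * (2 * Real.posLog (r.factorial) ^ 2) +
    8 * r ^ 2 * (2 * Real.pi + ∑ i, ∑ j, C i j), fun ρ h0 h1 => ?_⟩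
  have hcX : ∀ i j, Continuous fun t : ℝ => X ((ρ:ℂ) * Complex.exp (t * Complex.I)) i j :=
    fun i j => continuous_on_circle (hX i j).1 h0 h1
  have hcS : Continuous fun t : ℝ =>
      1 + ∑ i, ∑ j, ‖X ((ρ:ℂ) * Complex.exp (t * Complex.I)) i j‖ ^ 2 :=
    continuous_const.add <| continuous_finsetSum _ fun i _ => continuous_finsetSum _ fun j _ =>
      (hcX i j).norm.pow 2
  have hcdet : Continuous fun t : ℝ => (X ((ρ:ℂ) * Complex.exp (t * Complex.I))).det :=
    Continuous.matrix_det (continuous_matrix hcX)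
  have hpt : ∀ Y : Matrix (Fin r) (Fin r) ℂ, Real.posLog ‖Y.det‖ ^ 2 ≤
      2 * Real.posLog (r.factorial) ^ 2 + 8 * r ^ 2 * (1 + ∑ i, ∑ j, ‖Y i j‖ ^ 2) := by
    intro Y
    set S := 1 + ∑ i, ∑ j, ‖Y i j‖ ^ 2 with hS
    have hS1 : 1 ≤ S := by
      have : 0 ≤ ∑ i, ∑ j, ‖Y i j‖ ^ 2 := by positivity
      linarith
    have hent : ∀ i j, ‖Y i j‖ ≤ S := fun i j => by
      have h1 : ‖Y i j‖ ^ 2 ≤ ∑ j, ‖Y i j‖ ^ 2 :=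
        Finset.single_le_sum (f := fun j => ‖Y i j‖ ^ 2) (fun _ _ => by positivity)
          (Finset.mem_univ j)
      have h2 : ∑ j, ‖Y i j‖ ^ 2 ≤ ∑ i, ∑ j, ‖Y i j‖ ^ 2 :=
        Finset.single_le_sum (f := fun i => ∑ j, ‖Y i j‖ ^ 2) (fun _ _ => by positivity)
          (Finset.mem_univ i)
      nlinarith [sq_nonneg (‖Y i j‖ - 1)]
    have hdet : ‖Y.det‖ ≤ r.factorial * S ^ r := by
      have h := Matrix.det_le (A := Y) (abv := NormedField.toAbsoluteValue ℂ) (x := S) hent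
      rw [nsmul_eq_mul, Fintype.card_fin] at h
      exact h
    have hlogS : Real.posLog S ≤ 2 * √S := by
      rw [Real.posLog_eq_log (by rwa [abs_of_nonneg (by linarith)])]
      have h1 := Real.log_le_sub_one_of_pos (Real.sqrt_pos.2 (by linarith : 0 < S))
      rw [Real.log_sqrt (by linarith)] at h1
      linarith
    have hlog : Real.posLog ‖Y.det‖ ≤ Real.posLog r.factorial + r * Real.posLog S := by
      rw [← Real.posLog_pow]
      exact (Real.posLog_le_posLog (norm_nonneg _) hdet).trans Real.posLog_mul
    have hp0 : 0 ≤ Real.posLog S := Real.posLog_nonneg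
    have hsq : Real.posLog S ^ 2 ≤ 4 * S := by
      calc Real.posLog S ^ 2 ≤ (2 * √S) ^ 2 := by gcongr
        _ = 4 * S := by rw [mul_pow, Real.sq_sqrt (by linarith)]; norm_num
    calc Real.posLog ‖Y.det‖ ^ 2 ≤ (Real.posLog r.factorial + r * Real.posLog S) ^ 2 :=
          pow_le_pow_left₀ Real.posLog_nonneg hlog 2
      _ ≤ 2 * Real.posLog r.factorial ^ 2 + 2 * (r * Real.posLog S) ^ 2 := add_sq_le.trans
          (by linarith)
      _ = 2 * Real.posLog r.factorial ^ 2 + 2 * r ^ 2 * Real.posLog S ^ 2 := by ring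
      _ ≤ 2 * Real.posLog r.factorial ^ 2 + 2 * r ^ 2 * (4 * S) := by gcongr
      _ = _ := by ring
  have hpos := Real.two_pi_pos
  calc ∫ t in (0:ℝ)..(2 * Real.pi),
        Real.posLog ‖(X ((ρ:ℂ) * Complex.exp (t * Complex.I))).det‖ ^ 2
      ≤ ∫ t in (0:ℝ)..(2 * Real.pi), (2 * Real.posLog (r.factorial) ^ 2 +
        8 * r ^ 2 * (1 + ∑ i, ∑ j, ‖X ((ρ:ℂ) * Complex.exp (t * Complex.I)) i j‖ ^ 2)) :=
        intervalIntegral.integral_mono_on hpos.le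
          (((Real.continuous_posLog.comp hcdet.norm).pow 2).intervalIntegrable _ _)
          ((continuous_const.add (continuous_const.mul hcS)).intervalIntegrable _ _)
          fun t _ => hpt _
    _ = 2 * Real.pi * (2 * Real.posLog (r.factorial) ^ 2) + 8 * r ^ 2 * (2 * Real.pi +
        ∑ i, ∑ j, ∫ t in (0:ℝ)..(2 * Real.pi),
          ‖X ((ρ:ℂ) * Complex.exp (t * Complex.I)) i j‖ ^ 2) := by
        simpa using integral_const_add_mul_sum (fun i j => (hcX i j).norm.pow 2)
          (2 * Real.posLog (r.factorial) ^ 2) (8 * r ^ 2) 0 (2 * Real.pi)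
    _ ≤ _ := by
        gcongr with i _ j _
        simpa using hC i j ρ h0 h1

theorem ae_boundary_ne_zero {D H : ℂ → ℂ} {c : ℂ} (hD : LogSqMeanBounded D)
    (hH : DifferentiableOn ℂ H (ball (0:ℂ) 1)) (hc : ‖c‖ = 1)
    (hDH : ∀ z ∈ ball (0:ℂ) 1, D z = c * Complex.exp (H z)) {F : ℝ → ℂ}
    (hF : IsBoundaryValue D F) :
    ∀ᵐ (t : ℝ) ∂(volume.restrict (Set.Ioc (0:ℝ) (2*Real.pi))), F t ≠ 0 := by
  obtain ⟨hd, K, hK⟩ := hD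
  have hpos := Real.two_pi_pos
  have hlogD : ∀ z ∈ ball (0:ℂ) 1, Real.log ‖D z‖ = (H z).re := fun z hz => by
    rw [hDH z hz, norm_mul, hc, one_mul, Complex.norm_exp, Real.log_exp]
  have hmean : ∀ ρ : ℝ, 0 ≤ ρ → ρ < 1 → ∫ t in (0:ℝ)..(2 * Real.pi),
      (H ((ρ:ℂ) * Complex.exp (t * Complex.I))).re = 2 * Real.pi * (H 0).re := by
    intro ρ h0 h1
    have hsub : closedBall (0:ℂ) ρ ⊆ ball 0 1 := closedBall_subset_ball h1
    have hdc : DiffContOnCl ℂ H (ball (0:ℂ) |ρ|) := by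
      rw [abs_of_nonneg h0]
      exact (hH.mono (closure_ball_subset_closedBall.trans hsub)).diffContOnCl
    have h := hdc.circleAverage
    have hci : CircleIntegrable H 0 ρ := ContinuousOn.circleIntegrable h0
      (hH.continuousOn.mono (sphere_subset_closedBall.trans hsub))
    have h2 := Complex.reCLM.circleAverage_comp_comm hci
    rw [h] at h2
    simp only [Real.circleAverage_def, circleMap, zero_add, Function.comp,
      Complex.reCLM_apply, smul_eq_mul] at h2
    rw [← h2, mul_inv_cancel_left₀ hpos.ne']
  set M : ℝ := 2 * (2 * Real.pi + K) - 2 * Real.pi * (H 0).re with hM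
  have hbound : ∀ ρ : ℝ, 0 ≤ ρ → ρ < 1 → ∫ t in (0:ℝ)..(2 * Real.pi),
      |(H ((ρ:ℂ) * Complex.exp (t * Complex.I))).re| ≤ M := by
    intro ρ h0 h1
    have hcH : Continuous fun t : ℝ => (H ((ρ:ℂ) * Complex.exp (t * Complex.I))).re :=
      Complex.continuous_re.comp (continuous_on_circle hH h0 h1)
    have hcp : Continuous fun t : ℝ =>
        Real.posLog ‖D ((ρ:ℂ) * Complex.exp (t * Complex.I))‖ :=
      Real.continuous_posLog.comp (continuous_on_circle hd h0 h1).norm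
    calc ∫ t in (0:ℝ)..(2 * Real.pi), |(H ((ρ:ℂ) * Complex.exp (t * Complex.I))).re|
        ≤ ∫ t in (0:ℝ)..(2 * Real.pi),
          (2 * (1 + Real.posLog ‖D ((ρ:ℂ) * Complex.exp (t * Complex.I))‖ ^ 2) -
            (H ((ρ:ℂ) * Complex.exp (t * Complex.I))).re) := by
          refine intervalIntegral.integral_mono_on hpos.le (hcH.abs.intervalIntegrable _ _)
            (((continuous_const.mul (continuous_const.add (hcp.pow 2))).sub
              hcH).intervalIntegrable _ _) fun t _ => ?_
          rw [← hlogD _ (mul_exp_mem_ball h0 h1 t)]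
          have := Real.half_mul_log_add_log_abs
            (x := ‖D ((ρ:ℂ) * Complex.exp (t * Complex.I))‖)
          nlinarith [sq_nonneg (Real.posLog ‖D ((ρ:ℂ) * Complex.exp (t * Complex.I))‖ - 1)]
      _ = 2 * (2 * Real.pi + ∫ t in (0:ℝ)..(2 * Real.pi),
          Real.posLog ‖D ((ρ:ℂ) * Complex.exp (t * Complex.I))‖ ^ 2) -
            2 * Real.pi * (H 0).re := by
          rw [intervalIntegral.integral_sub
            (Continuous.intervalIntegrable (by fun_prop) _ _)
            (hcH.intervalIntegrable _ _), hmean ρ h0 h1, intervalIntegral.integral_const_mul,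
            intervalIntegral.integral_add intervalIntegrable_const
            (Continuous.intervalIntegrable (by fun_prop) _ _)]
          simp
      _ ≤ M := by
          rw [hM]; linarith [hK ρ h0 h1]
  obtain ⟨ρ, -, hρ1, hρlim⟩ := exists_seq_strictMono_tendsto' (zero_lt_one (α := ℝ))
  have hρlim' : Filter.Tendsto ρ Filter.atTop (nhdsWithin 1 (Set.Iio 1)) :=
    tendsto_nhdsWithin_iff.2 ⟨hρlim, Filter.Eventually.of_forall fun n => (hρ1 n).2⟩
  set φ : ℕ → ℝ → ENNReal := fun n t =>
    ENNReal.ofReal |(H ((ρ n:ℂ) * Complex.exp (t * Complex.I))).re| with hφ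
  have hcφ : ∀ n, Continuous fun t : ℝ =>
      |(H ((ρ n:ℂ) * Complex.exp (t * Complex.I))).re| := fun n =>
    (Complex.continuous_re.comp (continuous_on_circle hH (hρ1 n).1.le (hρ1 n).2)).abs
  have hφm : ∀ n, Measurable (φ n) := fun n =>
    (hcφ n).measurable.ennreal_ofReal
  have hfin : ∫⁻ t in Set.Ioc (0:ℝ) (2*Real.pi), Filter.liminf (fun n => φ n t) Filter.atTop
      ≤ ENNReal.ofReal M := by
    refine (lintegral_liminf_le hφm).trans ?_
    refine (Filter.liminf_le_liminf (v := fun _ => ENNReal.ofReal M)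
      (Filter.Eventually.of_forall fun n => ?_)).trans (by simp)
    rw [hφ, ← ofReal_integral_eq_lintegral_ofReal
      (((hcφ n).intervalIntegrable 0 (2 * Real.pi)).1)
      (Filter.Eventually.of_forall fun _ => abs_nonneg _),
      ← intervalIntegral.integral_of_le hpos.le]
    exact ENNReal.ofReal_le_ofReal (hbound _ (hρ1 n).1.le (hρ1 n).2)
  have hae := ae_lt_top (Measurable.liminf hφm)
    (lt_of_le_of_lt hfin ENNReal.ofReal_lt_top).ne
  filter_upwards [hae, hF] with t ht hFt h0
  rw [h0] at hFt
  refine ht.ne ?_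
  refine Filter.Tendsto.liminf_eq (ENNReal.tendsto_ofReal_atTop.comp ?_)
  have h1 : Filter.Tendsto (fun n => ‖D ((ρ n:ℂ) * Complex.exp (t * Complex.I))‖)
      Filter.atTop (nhdsWithin 0 {0}ᶜ) := by
    refine tendsto_nhdsWithin_iff.2 ⟨by simpa using (hFt.comp hρlim').norm,
      Filter.Eventually.of_forall fun n => ?_⟩
    rw [hDH _ (mul_exp_mem_ball (hρ1 n).1.le (hρ1 n).2 t)]
    have : c ≠ 0 := by rintro rfl; simp at hc
    simp [this]
  have h2 := Filter.tendsto_abs_atBot_atTop.comp (Real.tendsto_log_nhdsNE_zero.comp h1)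
  refine h2.congr fun n => ?_
  simp only [Function.comp]
  rw [hlogD _ (mul_exp_mem_ball (hρ1 n).1.le (hρ1 n).2 t)]

theorem LogSqMeanBounded.of_norm_le {f g : ℂ → ℂ} (hg : LogSqMeanBounded g)
    (hf : DifferentiableOn ℂ f (ball (0:ℂ) 1)) {M : ℝ}
    (h : ∀ z ∈ ball (0:ℂ) 1, ‖f z‖ ≤ M * ‖g z‖) : LogSqMeanBounded f := by
  obtain ⟨hd, K, hK⟩ := hg
  refine ⟨hf, 2 * Real.pi * (2 * Real.posLog M ^ 2) + 2 * K, fun ρ h0 h1 => ?_⟩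
  have hcg : Continuous fun t : ℝ =>
      Real.posLog ‖g ((ρ:ℂ) * Complex.exp (t * Complex.I))‖ :=
    Real.continuous_posLog.comp (continuous_on_circle hd h0 h1).norm
  have hcf : Continuous fun t : ℝ =>
      Real.posLog ‖f ((ρ:ℂ) * Complex.exp (t * Complex.I))‖ :=
    Real.continuous_posLog.comp (continuous_on_circle hf h0 h1).norm
  calc ∫ t in (0:ℝ)..(2 * Real.pi), Real.posLog ‖f ((ρ:ℂ) * Complex.exp (t * Complex.I))‖ ^ 2
      ≤ ∫ t in (0:ℝ)..(2 * Real.pi), (2 * Real.posLog M ^ 2 +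
          2 * Real.posLog ‖g ((ρ:ℂ) * Complex.exp (t * Complex.I))‖ ^ 2) := by
        refine intervalIntegral.integral_mono_on Real.two_pi_pos.le
          (Continuous.intervalIntegrable (by fun_prop) _ _)
          (Continuous.intervalIntegrable (by fun_prop) _ _) fun t _ => ?_
        have hle := (Real.posLog_le_posLog (norm_nonneg _)
          (h _ (mul_exp_mem_ball h0 h1 t))).trans Real.posLog_mul
        refine (pow_le_pow_left₀ Real.posLog_nonneg hle 2).trans (add_sq_le.trans ?_)
        linarith
    _ = 2 * Real.pi * (2 * Real.posLog M ^ 2) + 2 * ∫ t in (0:ℝ)..(2 * Real.pi),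
          Real.posLog ‖g ((ρ:ℂ) * Complex.exp (t * Complex.I))‖ ^ 2 := by
        rw [intervalIntegral.integral_add intervalIntegrable_const
          (Continuous.intervalIntegrable (by fun_prop) _ _), intervalIntegral.integral_const,
          intervalIntegral.integral_const_mul, sub_zero, smul_eq_mul]
    _ ≤ _ := by linarith [hK ρ h0 h1]

theorem IsOuter.exists_circleAverage {D : ℂ → ℂ} (hD : IsOuter D) :
    ∃ (c : ℂ) (u : ℂ → ℝ), ‖c‖ = 1 ∧ CircleIntegrable u 0 1 ∧ ∀ z ∈ ball (0:ℂ) 1,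
      D z = c * Complex.exp
        (Real.circleAverage (fun ζ => herglotzRieszKernel 0 z ζ • (u ζ : ℂ)) 0 1) := by
  obtain ⟨c, k, hc, hk, hD⟩ := hD
  have hpos := Real.two_pi_pos
  have hu : ∀ t ∈ uIoc 0 (2 * Real.pi),
      Real.log (k (Complex.arg (-circleMap 0 1 t) + Real.pi)) = Real.log (k t) := by
    intro t ht
    rw [uIoc_of_le hpos.le] at ht
    have : -circleMap 0 1 t = Complex.exp ((t - Real.pi : ℝ) * Complex.I) := by
      simp [circleMap, sub_mul, Complex.exp_sub, Complex.exp_pi_mul_I, div_neg]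
    rw [this, Complex.exp_mul_I, ← Complex.ofReal_cos, ← Complex.ofReal_sin]
    simp only [Complex.ofReal_cos, Complex.ofReal_sin]
    rw [Complex.arg_cos_add_sin_mul_I ⟨by linarith [ht.1], by linarith [ht.2]⟩]
    simp
  refine ⟨c, fun ζ => Real.log (k (Complex.arg (-ζ) + Real.pi)), hc, ?_, fun z hz => ?_⟩
  · exact hk.congr fun t ht => (hu t ht).symm
  · rw [hD z hz, Real.circleAverage_def]
    congr 2
    rw [Complex.real_smul]
    congr 1
    · simp
    refine intervalIntegral.integral_congr_ae (Filter.Eventually.of_forall fun t ht => ?_)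
    simp only [hu t ht, herglotzRieszKernel, sub_zero, smul_eq_mul]
    simp [circleMap]

theorem circleAverage_kernel_const {w : ℂ} (hw : w ∈ ball (0:ℂ) 1) (a : ℝ) :
    Real.circleAverage ((re ∘ herglotzRieszKernel 0 w) • fun _ => a) 0 1 = a :=
  InnerProductSpace.HarmonicOnNhd.circleAverage_re_herglotzRieszKernel_smul
    (fun _ _ => InnerProductSpace.harmonicAt_const a) hw

theorem exists_bounded_damping {D : ℂ → ℂ} {c : ℂ} {u : ℂ → ℝ} (hc : ‖c‖ = 1)
    (hu : CircleIntegrable u 0 1)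
    (hD : ∀ z ∈ ball (0:ℂ) 1, D z = c * Complex.exp
        (Real.circleAverage (fun ζ => herglotzRieszKernel 0 z ζ • (u ζ : ℂ)) 0 1)) :
    ∃ h : ℕ → ℂ → ℂ, ∀ n, DifferentiableOn ℂ (h n) (ball (0:ℂ) 1) ∧
      (∀ z ∈ ball (0:ℂ) 1, ‖h n z‖ ≤ 1 ∧ ‖h n z‖ ≤ Real.exp n * ‖D z‖) ∧
      ∀ z ∈ ball (0:ℂ) 1, Filter.Tendsto (fun n => ‖h n z‖) Filter.atTop (nhds 1) := by
  set φ : ℕ → ℂ → ℝ := fun n ζ => max (-u ζ - n) 0 with hφ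
  have hφle : ∀ n ζ, |φ n ζ| ≤ |u ζ| := fun n ζ => by
    rw [abs_of_nonneg (le_max_right _ _)]
    refine max_le ?_ (abs_nonneg _)
    linarith [neg_le_abs (u ζ), (Nat.cast_nonneg n : (0:ℝ) ≤ n)]
  have hφi : ∀ n, CircleIntegrable (φ n) 0 1 := fun n => by
    have h1 : CircleIntegrable (fun ζ => -u ζ - n) 0 1 :=
      hu.neg.sub (circleIntegrable_const (n : ℝ) 0 1)
    exact ⟨h1.1.sup (integrable_zero _ _ _), h1.2.sup (integrable_zero _ _ _)⟩
  have hnorm : ∀ n, ∀ z ∈ ball (0:ℂ) 1, ‖Complex.exp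
      (-Real.circleAverage (fun ζ => herglotzRieszKernel 0 z ζ • (φ n ζ : ℂ)) 0 1)‖ =
      Real.exp (-Real.circleAverage ((re ∘ herglotzRieszKernel 0 z) • φ n) 0 1) := by
    intro n z hz
    rw [Complex.norm_exp, Complex.neg_re, re_circleAverage_herglotzRieszKernel_smul (hφi n) hz]
  refine ⟨fun n z => Complex.exp
    (-Real.circleAverage (fun ζ => herglotzRieszKernel 0 z ζ • (φ n ζ : ℂ)) 0 1),
    fun n => ⟨?_, fun z hz => ⟨?_, ?_⟩, fun z hz => ?_⟩⟩
  · have hi : CircleIntegrable (fun ζ => (φ n ζ : ℂ)) 0 1 :=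
      ⟨(hφi n).1.ofReal, (hφi n).2.ofReal⟩
    exact (differentiableOn_circleAverage_herglotzRieszKernel_smul hi).neg.cexp
  · rw [hnorm n z hz, Real.exp_le_one_iff, neg_nonpos]
    exact circleAverage_kernel_nonneg hz fun _ _ => le_max_right _ _
  · rw [hnorm n z hz, hD z hz, norm_mul, hc, one_mul, Complex.norm_exp,
      re_circleAverage_herglotzRieszKernel_smul hu hz, ← Real.exp_add, Real.exp_le_exp]
    have h1 := circleAverage_kernel_nonneg hz (g := (φ n + u) + fun _ => (n:ℝ)) fun ζ _ => by
      simp only [hφ, Pi.add_apply]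
      linarith [le_max_left (-u ζ - n) 0]
    rw [smul_add, smul_add, Real.circleAverage_add
      ((circleIntegrable_kernel_smul hz (hφi n)).add (circleIntegrable_kernel_smul hz hu))
      (circleIntegrable_kernel_smul hz (circleIntegrable_const _ _ _)),
      Real.circleAverage_add (circleIntegrable_kernel_smul hz (hφi n))
        (circleIntegrable_kernel_smul hz hu), circleAverage_kernel_const hz] at h1
    linarith
  · have hint : Filter.Tendsto (fun n => Real.circleAverage (φ n) 0 1) Filter.atTop (nhds 0) := by
      have h1 := intervalIntegral.tendsto_integral_filter_of_dominated_convergence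
        (μ := volume) (a := 0) (b := 2 * Real.pi) (l := Filter.atTop)
        (F := fun n t => φ n (circleMap 0 1 t)) (f := fun _ => 0)
        (fun t => |u (circleMap 0 1 t)|)
        (Filter.Eventually.of_forall fun n => (intervalIntegrable_iff.1 (hφi n)).1)
        (Filter.Eventually.of_forall fun n => Filter.Eventually.of_forall fun t _ => hφle n _)
        hu.abs
        (Filter.Eventually.of_forall fun t _ => ?_)
      · simpa [Real.circleAverage_def] using h1.const_mul (2 * Real.pi)⁻¹
      · obtain ⟨m, hm⟩ := exists_nat_ge (-u (circleMap 0 1 t))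
        refine tendsto_const_nhds.congr' (Filter.eventually_atTop.2 ⟨m, fun n hn => ?_⟩)
        have : (m : ℝ) ≤ n := by exact_mod_cast hn
        exact (max_eq_right (by linarith)).symm
    have hP : Filter.Tendsto (fun n => Real.circleAverage
        ((re ∘ herglotzRieszKernel 0 z) • φ n) 0 1) Filter.atTop (nhds 0) :=
      squeeze_zero (fun n => circleAverage_kernel_nonneg hz fun _ _ => le_max_right _ _)
        (fun n => circleAverage_kernel_le hz (hφi n) fun _ _ => le_max_right _ _)
        (by simpa using hint.const_mul ((1 + ‖z‖) / (1 - ‖z‖)))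
    refine Filter.Tendsto.congr (fun n => (hnorm n z hz).symm) ?_
    have hexp := (Real.continuous_exp.tendsto _).comp hP.neg
    rwa [neg_zero, Real.exp_zero] at hexp

theorem norm_le_of_outer_denominator {N D : ℂ → ℂ} {F G : ℝ → ℂ} (hN : LogSqMeanBounded N)
    (hD : LogSqMeanBounded D) (hDo : IsOuter D) (hNF : IsBoundaryValue N F)
    (hDG : IsBoundaryValue D G) {C : ℝ} (hC : 0 < C)
    (hb : ∀ᵐ (t : ℝ) ∂(volume.restrict (Set.Ioc (0:ℝ) (2*Real.pi))), ‖F t / G t‖ ≤ C)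
    {w : ℂ} (hw : w ∈ ball (0:ℂ) 1) : ‖N w / D w‖ ≤ C := by
  obtain ⟨c, u, hc, hu, hDu⟩ := hDo.exists_circleAverage
  have hc0 : c ≠ 0 := by rintro rfl; simp at hc
  have hD0 : ∀ z ∈ ball (0:ℂ) 1, D z ≠ 0 := fun z hz => by
    rw [hDu z hz]; exact mul_ne_zero hc0 (Complex.exp_ne_zero _)
  have hui : CircleIntegrable (fun ζ => (u ζ : ℂ)) 0 1 := ⟨hu.1.ofReal, hu.2.ofReal⟩
  have hG0 := ae_boundary_ne_zero hD
    (differentiableOn_circleAverage_herglotzRieszKernel_smul hui) hc hDu hDG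
  obtain ⟨h, hh⟩ := exists_bounded_damping hc hu hDu
  have hdamp : ∀ n, ‖h n w * (N w / D w) / C‖ ≤ 1 := by
    intro n
    obtain ⟨hhd, hhb, -⟩ := hh n
    refine norm_le_one_of_boundary (f := fun z => h n z * (N z / D z) / C)
      (hN.of_norm_le (M := Real.exp n / C)
        ((hhd.mul (hN.1.div hD.1 hD0)).div_const _) fun z hz => ?_) ?_ hw
    · have hDz : 0 < ‖D z‖ := norm_pos_iff.2 (hD0 z hz)
      rw [norm_div, norm_mul, norm_div, Complex.norm_real, Real.norm_of_nonneg hC.le,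
        div_mul_eq_mul_div]
      refine div_le_div_of_nonneg_right ?_ hC.le
      calc ‖h n z‖ * (‖N z‖ / ‖D z‖) ≤ Real.exp n * ‖D z‖ * (‖N z‖ / ‖D z‖) := by
            gcongr; exact (hhb z hz).2
        _ = Real.exp n * ‖N z‖ := by field_simp
    · filter_upwards [hG0, hNF, hDG, hb] with t hGt hNt hDt hbt
      have hlim := (Real.continuous_posLog.tendsto _).comp
        ((hNt.div hDt hGt).norm.div_const C)
      have h0 : Real.posLog (‖F t / G t‖ / C) = 0 := by
        rw [Real.posLog_eq_zero_iff, abs_of_nonneg (by positivity)]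
        exact (div_le_one hC).2 hbt
      rw [h0] at hlim
      refine tendsto_of_tendsto_of_tendsto_of_le_of_le' tendsto_const_nhds hlim
        (Filter.Eventually.of_forall fun _ => Real.posLog_nonneg) ?_
      filter_upwards [eventually_lt_and_lt_one zero_lt_one] with ρ hρ
      refine Real.posLog_le_posLog (norm_nonneg _) ?_
      rw [norm_div, norm_mul, Complex.norm_real, Real.norm_of_nonneg hC.le]
      refine div_le_div_of_nonneg_right ?_ hC.le
      exact mul_le_of_le_one_left (norm_nonneg _)
        (hhb _ (mul_exp_mem_ball hρ.1.le hρ.2 t)).1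
  have hlim : Filter.Tendsto (fun n => ‖h n w‖ * ‖N w / D w‖) Filter.atTop
      (nhds (1 * ‖N w / D w‖)) := ((hh 0).2.2 w hw).mul_const _
  rw [one_mul] at hlim
  refine le_of_tendsto hlim (Filter.Eventually.of_forall fun n => ?_)
  have := hdamp n
  rwa [norm_div, norm_mul, Complex.norm_real, Real.norm_of_nonneg hC.le, div_le_one hC] at this

theorem isBoundaryValue_det {r : ℕ} {X : ℂ → Matrix (Fin r) (Fin r) ℂ}
    {Y : ℝ → Matrix (Fin r) (Fin r) ℂ}
    (h : ∀ i j, IsBoundaryValue (fun z => X z i j) (fun t => Y t i j)) :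
    IsBoundaryValue (fun z => (X z).det) (fun t => (Y t).det) := by
  unfold IsBoundaryValue at h ⊢
  simp only [← ae_all_iff] at h
  filter_upwards [h] with t ht
  have hlim := tendsto_pi_nhds.2 fun i => tendsto_pi_nhds.2 fun j => ht i j
  exact ((continuous_id.matrix_det (n := Fin r) (R := ℂ)).tendsto (Y t)).comp hlim

theorem inv_mul_apply_eq_det_div {r : ℕ} (A B : Matrix (Fin r) (Fin r) ℂ) (i j : Fin r) :
    (A⁻¹ * B) i j = (A.updateCol i fun k => B k j).det / A.det := by
  rw [Matrix.inv_def, Matrix.smul_mul, Matrix.smul_apply, Ring.inverse_eq_inv', smul_eq_mul,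
    ← Matrix.cramer_apply, Matrix.cramer_eq_adjugate_mulVec, div_eq_inv_mul]
  rfl

/-- If `A, B` are `H_2` matrix functions with outer, not identically vanishing determinants and
`A⁻¹B` has `L_∞` boundary values, then `A⁻¹B` extends to an `H_∞` matrix function. -/
theorem Ainv_mul_B_Hinf (r : ℕ) (A B : ℂ → (Matrix (Fin r) (Fin r) ℂ))
    (hA2 : ∀ i j, HardyMem 2 (fun z => A z i j))
    (hB2 : ∀ i j, HardyMem 2 (fun z => B z i j))
    (hdA : IsOuter (fun z => (A z).det)) (hdB : IsOuter (fun z => (B z).det))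
    (hAne : ¬ ∀ z ∈ Metric.ball (0:ℂ) 1, (A z).det = 0)
    (hBne : ¬ ∀ z ∈ Metric.ball (0:ℂ) 1, (B z).det = 0)
    (BA BB : ℝ → (Matrix (Fin r) (Fin r) ℂ))
    (hBA : ∀ i j, IsBoundaryValue (fun z => A z i j) (fun t => BA t i j))
    (hBB : ∀ i j, IsBoundaryValue (fun z => B z i j) (fun t => BB t i j))
    (hbdd : ∃ C : ℝ, ∀ᵐ (t : ℝ) ∂(MeasureTheory.volume.restrict (Set.Ioc (0:ℝ) (2*Real.pi))), ∀ i j, ‖((BA t)⁻¹ * BB t) i j‖ ≤ C) :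
    ∃ V : ℂ → (Matrix (Fin r) (Fin r) ℂ),
      (∀ i j, HardyInfMem (fun z => V z i j)) ∧
      ∀ z ∈ Metric.ball (0:ℂ) 1, (A z).det ≠ 0 → V z = (A z)⁻¹ * B z := by
  have hentry {P : (ℂ → ℂ) → Prop} (hA : ∀ i j, P fun z => A z i j)
      (hB : ∀ i j, P fun z => B z i j) (i j k l : Fin r) :
      P fun z => (A z).updateCol i (fun k => B z k j) k l := by
    rcases eq_or_ne l i with rfl | h
    · simpa using hB k j
    · simpa [Matrix.updateCol_ne h] using hA k l
  have hboundary (i j k l : Fin r) :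
      IsBoundaryValue (fun z => (A z).updateCol i (fun k => B z k j) k l)
        (fun t => (BA t).updateCol i (fun k => BB t k j) k l) := by
    rcases eq_or_ne l i with rfl | h
    · simpa using hBB k j
    · simpa [Matrix.updateCol_ne h] using hBA k l
  have hN (i j : Fin r) := logSqMeanBounded_det
    (X := fun z => (A z).updateCol i fun k => B z k j) (hentry hA2 hB2 i j)
  have hD := logSqMeanBounded_det hA2
  have hD0 : ∀ z ∈ Metric.ball (0:ℂ) 1, (A z).det ≠ 0 := by
    obtain ⟨c, k, hc, -, hD⟩ := hdA
    intro z hz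
    refine (hD z hz).trans_ne ?_
    exact mul_ne_zero (by rintro rfl; simp at hc) (Complex.exp_ne_zero _)
  obtain ⟨C, hC⟩ := hbdd
  refine ⟨fun z => (A z)⁻¹ * B z, fun i j => ⟨?_, max C 1, fun z hz => ?_⟩, fun _ _ _ => rfl⟩
  · simp only [inv_mul_apply_eq_det_div]
    exact (hN i j).1.div hD.1 hD0
  · simp only [inv_mul_apply_eq_det_div]
    refine norm_le_of_outer_denominator (hN i j) hD hdA (isBoundaryValue_det (hboundary i j))
      (isBoundaryValue_det hBA) (by positivity) ?_ hz
    filter_upwards [hC] with t ht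
    rw [← inv_mul_apply_eq_det_div]
    exact (ht i j).trans (le_max_left _ _)
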